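/- Let ↑n = {m ∈ ℕ | m ≥ n} and g : Set ℕ → Set ℕ be given by g(p) = ⋃_{n ∈ ℕ} ((↑n) → p), so that L'(g) represents Pitts' local operator (induced by the family of cofinite subsets of ℕ). Call D ⊆ ℕ Pitts-decidable if there is a total recursive function h with h(n) ∈ L'(g)({χ_D(n)}) for all n, where χ_D(n) = 0 if n ∈ D and 1 otherwise. Then: (a) every computable D ⊆ ℕ is Pitts-decidable; (b) if D is Pitts-decidable then so is its complement ℕ \ D; (c) if A ⊆ ℕ is Pitts-decidable then so is {x ∈ ℕ | ∃n, ⟨x,n⟩ ∈ A}. Consequently Pitts' local operator forces every arithmetically definable subset of ℕ to be decidable. -/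

import Mathlib

open scoped Classical

/-- Kleene application: value of the `e`-th partial recursive function at `x`. -/
def kleene (e x : ℕ) : Part ℕ := (Denumerable.ofNat Nat.Partrec.Code e).eval x

/-- `A ∧ B = {⟨a,b⟩ | a ∈ A, b ∈ B}`. -/
def setAnd (A B : Set ℕ) : Set ℕ := {x | ∃ a ∈ A, ∃ b ∈ B, x = Nat.pair a b}

/-- `A → B = {e | ∀ a ∈ A, e·a is defined and e·a ∈ B}`. -/
def setImp (A B : Set ℕ) : Set ℕ := {e | ∀ a ∈ A, ∃ v ∈ kleene e a, v ∈ B}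

/-- `E(f) = ⋂_{p,q} ((p → q) → (f p → f q))`. -/
def Efun (f : Set ℕ → Set ℕ) : Set ℕ :=
  ⋂ (p : Set ℕ) (q : Set ℕ), setImp (setImp p q) (setImp (f p) (f q))

/-- `L(f)(p) = ⋂_q (((p → q) ∧ (f q → q)) → q)`. -/
def Lop (f : Set ℕ → Set ℕ) (p : Set ℕ) : Set ℕ :=
  ⋂ (q : Set ℕ), setImp (setAnd (setImp p q) (setImp (f q) q)) q

/-- `L'(f)(p) = ⋂ {q | {0} ∧ p ⊆ q and {1} ∧ f q ⊆ q}`. -/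
def L' (f : Set ℕ → Set ℕ) (p : Set ℕ) : Set ℕ :=
  ⋂₀ {q : Set ℕ | setAnd {0} p ⊆ q ∧ setAnd {1} (f q) ⊆ q}

/-- A sight: either `NIL` or a pair `(A, σ)` with `σ` assigning a sight to each `a ∈ A`. -/
inductive Sight : Type
  | nil : Sight
  | node (A : Set ℕ) (σ : (a : ℕ) → a ∈ A → Sight) : Sight

/-- `S` is a `(z,θ,p)`-dedicated sight. -/
def Dedicated (B : Set ℕ) (θ : ℕ → Set (Set ℕ)) (p : Set ℕ) : ℕ → Sight → Prop
  | z, .nil => ∃ y ∈ p, z = Nat.pair 0 y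
  | z, .node A σ => ∃ n ∈ B, ∃ e : ℕ, z = Nat.pair 1 (Nat.pair n e) ∧ A ∈ θ n ∧
      ∀ a (ha : a ∈ A), ∃ v ∈ kleene e a, Dedicated B θ p v (σ a ha)

/-- The tree `Tr(S)` of a sight, as a predicate on (finite) sequences. -/
inductive InTr : Sight → List ℕ → Prop
  | nil : InTr Sight.nil []
  | emptyNode (A : Set ℕ) (σ : (a : ℕ) → a ∈ A → Sight) (hA : A = ∅) :
      InTr (Sight.node A σ) []
  | cons (A : Set ℕ) (σ : (a : ℕ) → a ∈ A → Sight) (a : ℕ) (ha : a ∈ A)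
      (t : List ℕ) (h : InTr (σ a ha) t) : InTr (Sight.node A σ) (a :: t)

/-- The good leaves of (the tree of) a sight. -/
inductive IsGoodLeaf : Sight → List ℕ → Prop
  | nil : IsGoodLeaf Sight.nil []
  | cons (A : Set ℕ) (σ : (a : ℕ) → a ∈ A → Sight) (a : ℕ) (ha : a ∈ A)
      (t : List ℕ) (h : IsGoodLeaf (σ a ha) t) : IsGoodLeaf (Sight.node A σ) (a :: t)

/-- `s` is a leaf of `Tr(S)`. -/
def IsLeaf (S : Sight) (s : List ℕ) : Prop := InTr S s ∧ ∀ a : ℕ, ¬ InTr S (s ++ [a])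

/-- `Out_S(s) = {a | s∗⟨a⟩ ∈ Tr(S)}`. -/
def OutS (S : Sight) (s : List ℕ) : Set ℕ := {a | InTr S (s ++ [a])}

/-- A sight is degenerate if some leaf of its tree is not a good leaf. -/
def Degenerate (S : Sight) : Prop := ∃ s, IsLeaf S s ∧ ¬ IsGoodLeaf S s

/-- A sight is on a family `𝒜` if all its outsets at non-leaves belong to `𝒜`. -/
def SightOn (S : Sight) (𝒜 : Set (Set ℕ)) : Prop :=
  ∀ s, InTr S s → ¬ IsLeaf S s → OutS S s ∈ 𝒜

/-- `S` is `(w,θ,p)`-supporting. -/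
def Supporting (B : Set ℕ) (θ : ℕ → Set (Set ℕ)) (p : Set ℕ) (w : ℕ) (S : Sight) : Prop :=
  (∀ s, IsGoodLeaf S s → ∃ y ∈ p, Nat.pair 0 y ∈ kleene w (Encodable.encode s)) ∧
  (∀ s, InTr S s → ¬ IsGoodLeaf S s →
    ∃ n ∈ B, Nat.pair 1 n ∈ kleene w (Encodable.encode s) ∧ OutS S s ∈ θ n)

/-- `z` is r-defined on `S` if `S` is `(z,θ,ℕ)`-dedicated for some `θ`. -/
def RDefined (z : ℕ) (S : Sight) : Prop :=
  ∃ (B : Set ℕ) (θ : ℕ → Set (Set ℕ)), B.Nonempty ∧ (∀ n ∈ B, (θ n).Nonempty) ∧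
    Dedicated B θ Set.univ z S

/-- `G_θ(p) = {⟨n,e⟩ | n ∈ B, e ∈ (A → p) for some A ∈ θ(n)}`. -/
def Gtheta (B : Set ℕ) (θ : ℕ → Set (Set ℕ)) (p : Set ℕ) : Set ℕ :=
  {z | ∃ n ∈ B, ∃ e, z = Nat.pair n e ∧ ∃ A ∈ θ n, e ∈ setImp A p}

/-- `G_𝒜(p) = ⋃_{A ∈ 𝒜} (A → p)`. -/
def GA (𝒜 : Set (Set ℕ)) (p : Set ℕ) : Set ℕ := ⋃ A ∈ 𝒜, setImp A p

/-- `𝒜 ≤_L ℬ`: the ordering of basic local operators. -/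
def leL (𝒜 ℬ : Set (Set ℕ)) : Prop := ∃ z : ℕ, ∀ A ∈ 𝒜, z ∈ L' (GA ℬ) A

/-- `𝒜` has the `n`-intersection property. -/
def nIntProp (𝒜 : Set (Set ℕ)) (n : ℕ) : Prop :=
  ∀ A : Fin n → Set ℕ, (∀ i, A i ∈ 𝒜) → (⋂ i, A i).Nonempty

/-- The segment `[α]`: `{1,…,α}` for finite `α`, and all of `ℕ` for `α = ω`. -/
def seg (α : ℕ∞) : Set ℕ :=
  WithTop.recTopCoe Set.univ (fun n => {k | 1 ≤ k ∧ k ≤ n}) α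

/-- `O^α_m`: the co-`m`-tons in `[α]`. -/
def Oam (α : ℕ∞) (m : ℕ) : Set (Set ℕ) :=
  {X | X ⊆ seg α ∧ (seg α \ X).Finite ∧ (seg α \ X).ncard = m}

/-- Characteristic function: `0` on `D`, `1` off `D`. -/
noncomputable def chiD (D : Set ℕ) : ℕ → ℕ := fun n => if n ∈ D then 0 else 1

/-- `↑n = {m | m ≥ n}`. -/
def upSet (n : ℕ) : Set ℕ := {m | n ≤ m}

/-- The monotone map inducing Pitts' local operator: `g(p) = ⋃_n ((↑n) → p)`. -/
def gPitts (p : Set ℕ) : Set ℕ := ⋃ n : ℕ, setImp (upSet n) p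

/-- `D` is decidable in the subtopos of Pitts' local operator. -/
def PittsDecidable (D : Set ℕ) : Prop :=
  ∃ h : ℕ → ℕ, Computable h ∧ ∀ n : ℕ, h n ∈ L' gPitts {chiD D n}

open Nat.Partrec in
theorem pitts_fix (f : ℕ → ℕ → ℕ) (hf : Computable₂ f) :
    ∃ B : ℕ → ℕ → ℕ, Computable₂ B ∧ ∃ c : Code,
      (∀ s z, Code.eval c (Nat.pair s z) = Part.some (B s z)) ∧
      (∀ s y, B s (Nat.pair 0 y) = f s y) ∧
      (∀ s e, B s (Nat.pair 1 e) =
        Nat.pair 1 (Encodable.encode (Code.comp (Code.curry c s) (Denumerable.ofNat Code e)))) := by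
  let F : Code → ℕ → ℕ := fun c n =>
    Nat.casesOn (motive := fun _ => ℕ) n.unpair.2.unpair.1 (f n.unpair.1 n.unpair.2.unpair.2)
      (fun _ => Nat.pair 1 (Encodable.encode
        (Code.comp (Code.curry c n.unpair.1) (Denumerable.ofNat Code n.unpair.2.unpair.2))))
  have hu1 : Computable (fun p : Code × ℕ => p.2.unpair.1) :=
    Computable.fst.comp (Computable.unpair.comp Computable.snd)
  have hu2 : Computable (fun p : Code × ℕ => p.2.unpair.2) :=
    Computable.snd.comp (Computable.unpair.comp Computable.snd)
  have hu21 : Computable (fun p : Code × ℕ => p.2.unpair.2.unpair.1) :=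
    Computable.fst.comp (Computable.unpair.comp hu2)
  have hu22 : Computable (fun p : Code × ℕ => p.2.unpair.2.unpair.2) :=
    Computable.snd.comp (Computable.unpair.comp hu2)
  have hF : Computable₂ F := by
    refine Computable.nat_casesOn (f := fun p : Code × ℕ => p.2.unpair.2.unpair.1)
      (g := fun p : Code × ℕ => f p.2.unpair.1 p.2.unpair.2.unpair.2)
      (h := fun (p : Code × ℕ) _ => Nat.pair 1 (Encodable.encode
        (Code.comp (Code.curry p.1 p.2.unpair.1) (Denumerable.ofNat Code p.2.unpair.2.unpair.2))))
      hu21 (hf.comp hu1 hu22) ?_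
    have h1 : Computable (fun p : Code × ℕ => Code.comp (Code.curry p.1 p.2.unpair.1)
        (Denumerable.ofNat Code p.2.unpair.2.unpair.2)) :=
      (Primrec₂.to_comp Code.primrec₂_comp).comp
        ((Primrec₂.to_comp Code.primrec₂_curry).comp Computable.fst hu1)
        ((Computable.ofNat Code).comp hu22)
    have h2 : Computable (fun p : Code × ℕ => Nat.pair 1 (Encodable.encode
        (Code.comp (Code.curry p.1 p.2.unpair.1)
        (Denumerable.ofNat Code p.2.unpair.2.unpair.2)))) :=
      (Primrec₂.to_comp Primrec₂.natPair).comp (Computable.const 1) (Computable.encode.comp h1)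
    exact (h2.comp Computable.fst).to₂
  obtain ⟨c, hc⟩ := Code.fixed_point₂ (f := fun c n => Part.some (F c n)) hF.partrec₂
  refine ⟨fun s z => F c (Nat.pair s z), ?_, c, ?_, ?_, ?_⟩
  · exact hF.comp (Computable.const c)
      ((Primrec₂.to_comp Primrec₂.natPair).comp Computable.fst Computable.snd)
  · intro s z; rw [hc]
  · intro s y; simp [F]
  · intro s e; simp [F]

theorem L'_ret {p : Set ℕ} {y : ℕ} (hy : y ∈ p) : Nat.pair 0 y ∈ L' gPitts p := by
  intro q hq
  exact hq.1 ⟨0, rfl, y, hy, rfl⟩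

theorem gPitts_mono {p q : Set ℕ} (h : p ⊆ q) : gPitts p ⊆ gPitts q := by
  intro e he
  obtain ⟨n, hn⟩ := Set.mem_iUnion.1 he
  refine Set.mem_iUnion.2 ⟨n, fun a ha => ?_⟩
  obtain ⟨v, hv, hvp⟩ := hn a ha
  exact ⟨v, hv, h hvp⟩

theorem L'_step {p : Set ℕ} {e : ℕ} (he : e ∈ gPitts (L' gPitts p)) :
    Nat.pair 1 e ∈ L' gPitts p := by
  intro q hq
  refine hq.2 ⟨1, rfl, e, gPitts_mono ?_ he, rfl⟩
  exact Set.sInter_subset_of_mem hq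

theorem pitts_bind (f : ℕ → ℕ → ℕ) (hf : Computable₂ f) :
    ∃ B : ℕ → ℕ → ℕ, Computable₂ B ∧ ∀ (s z : ℕ) (p q : Set ℕ), z ∈ L' gPitts p →
      (∀ y ∈ p, f s y ∈ L' gPitts q) → B s z ∈ L' gPitts q := by
  obtain ⟨B, hB, c, hc, h0, h1⟩ := pitts_fix f hf
  refine ⟨B, hB, fun s z p q hz hpq => ?_⟩
  refine hz {z | B s z ∈ L' gPitts q} ⟨?_, ?_⟩
  · rintro _ ⟨a, rfl, y, hy, rfl⟩
    simp only [Set.mem_setOf_eq, h0]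
    exact hpq y hy
  · rintro _ ⟨a, rfl, e, he, rfl⟩
    simp only [Set.mem_setOf_eq, h1]
    apply L'_step
    obtain ⟨n, hn⟩ := Set.mem_iUnion.1 he
    refine Set.mem_iUnion.2 ⟨n, fun a ha => ?_⟩
    obtain ⟨v, hv, hvp⟩ := hn a ha
    refine ⟨B s v, ?_, hvp⟩
    unfold kleene at hv ⊢
    rw [Denumerable.ofNat_encode]
    refine Part.mem_bind_iff.2 ⟨v, hv, ?_⟩
    rw [Nat.Partrec.Code.eval_curry, hc]
    exact Part.mem_some _

theorem pitts_search (h : ℕ → ℕ) (hh : Computable h) (A : Set ℕ)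
    (hA : ∀ n, h n ∈ L' gPitts {chiD A n}) :
    ∃ b : ℕ → ℕ → ℕ, Computable₂ b ∧ ∀ x m,
      b x m ∈ L' gPitts {if ∃ k < m, Nat.pair x k ∈ A then 0 else 1} := by
  let f : ℕ → ℕ → ℕ := fun s y => Nat.casesOn (motive := fun _ => ℕ) y (Nat.pair 0 0) (fun _ => s)
  have hf : Computable₂ f :=
    Computable.nat_casesOn (f := fun p : ℕ × ℕ => p.2) (g := fun _ => Nat.pair 0 0)
      (h := fun p _ => p.1) Computable.snd (Computable.const _)
      (Computable.fst.comp Computable.fst).to₂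
  obtain ⟨B, hB, hB'⟩ := pitts_bind f hf
  let b : ℕ → ℕ → ℕ := fun x m => Nat.rec (motive := fun _ => ℕ) (Nat.pair 0 1)
    (fun k ih => B ih (h (Nat.pair x k))) m
  refine ⟨b, ?_, ?_⟩
  · refine Computable.nat_rec (f := fun p : ℕ × ℕ => p.2) (g := fun _ => Nat.pair 0 1)
      (h := fun p r => B r.2 (h (Nat.pair p.1 r.1))) Computable.snd (Computable.const _) ?_
    refine hB.comp (Computable.snd.comp Computable.snd) (hh.comp ?_)
    exact (Primrec₂.to_comp Primrec₂.natPair).comp (Computable.fst.comp Computable.fst)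
      (Computable.fst.comp Computable.snd)
  · intro x m
    induction m with
    | zero => exact L'_ret (by simp)
    | succ k ih =>
      refine hB' (b x k) _ _ _ (hA (Nat.pair x k)) ?_
      rintro y rfl
      by_cases hk : Nat.pair x k ∈ A
      · have : ∃ j < k + 1, Nat.pair x j ∈ A := ⟨k, Nat.lt_succ_self k, hk⟩
        simp only [f, chiD, if_pos hk, if_pos this]
        exact L'_ret rfl
      · have : (∃ j < k + 1, Nat.pair x j ∈ A) ↔ ∃ j < k, Nat.pair x j ∈ A := by
          constructor
          · rintro ⟨j, hj, hjA⟩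
            refine ⟨j, ?_, hjA⟩
            rcases Nat.lt_succ_iff_lt_or_eq.1 hj with h | rfl
            · exact h
            · exact absurd hjA hk
          · rintro ⟨j, hj, hjA⟩
            exact ⟨j, by omega, hjA⟩
        simp only [f, chiD, if_neg hk, this]
        exact ih

theorem stmt19 :
    (∀ D : Set ℕ, ComputablePred (· ∈ D) → PittsDecidable D) ∧
    (∀ D : Set ℕ, PittsDecidable D → PittsDecidable Dᶜ) ∧
    (∀ A : Set ℕ, PittsDecidable A →
      PittsDecidable {x : ℕ | ∃ n : ℕ, Nat.pair x n ∈ A}) := by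
  refine ⟨?_, ?_, ?_⟩
  · rintro D ⟨hdec, hD⟩
    refine ⟨fun n => Nat.pair 0 (cond (decide (n ∈ D)) 0 1), ?_, ?_⟩
    · exact (Primrec₂.to_comp Primrec₂.natPair).comp (Computable.const 0)
        (Computable.cond hD (Computable.const 0) (Computable.const 1))
    · intro n
      apply L'_ret
      by_cases hn : n ∈ D <;> simp [chiD, hn]
  · rintro D ⟨h, hh, hD⟩
    obtain ⟨B, hB, hB'⟩ := pitts_bind (fun _ y => Nat.pair 0 (1 - y))
      ((Primrec₂.to_comp Primrec₂.natPair).comp (Computable.const 0)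
        ((Primrec₂.to_comp Primrec.nat_sub).comp (Computable.const 1) Computable.snd))
    refine ⟨fun n => B 0 (h n), hB.comp (Computable.const 0) hh, fun n => ?_⟩
    refine hB' 0 _ _ _ (hD n) ?_
    rintro y rfl
    apply L'_ret
    by_cases hn : n ∈ D <;> simp [chiD, hn]
  · rintro A ⟨h, hh, hA⟩
    obtain ⟨b, hb, hb'⟩ := pitts_search h hh A hA
    have hb2 : Computable (fun n : ℕ => b n.unpair.1 n.unpair.2) :=
      hb.comp (Computable.fst.comp Computable.unpair) (Computable.snd.comp Computable.unpair)
    obtain ⟨c, hc⟩ := Nat.Partrec.Code.exists_code.1 (Partrec.nat_iff.1 hb2.partrec)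
    refine ⟨fun x => Nat.pair 1 (Encodable.encode (Nat.Partrec.Code.curry c x)), ?_, ?_⟩
    · exact (Primrec₂.to_comp Primrec₂.natPair).comp (Computable.const 1)
        (Computable.encode.comp ((Primrec₂.to_comp Nat.Partrec.Code.primrec₂_curry).comp
          (Computable.const c) Computable.id))
    · intro x
      apply L'_step
      have key : ∃ n, ∀ m, n ≤ m → (if ∃ k < m, Nat.pair x k ∈ A then 0 else 1) =
          chiD {x : ℕ | ∃ n : ℕ, Nat.pair x n ∈ A} x := by
        by_cases hx : ∃ n : ℕ, Nat.pair x n ∈ A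
        · obtain ⟨n, hn⟩ := hx
          refine ⟨n + 1, fun m hm => ?_⟩
          have h1 : ∃ k < m, Nat.pair x k ∈ A := ⟨n, hm, hn⟩
          have h2 : x ∈ {x : ℕ | ∃ n : ℕ, Nat.pair x n ∈ A} := ⟨n, hn⟩
          rw [chiD, if_pos h1, if_pos h2]
        · refine ⟨0, fun m _ => ?_⟩
          have h1 : ¬ ∃ k < m, Nat.pair x k ∈ A := fun ⟨k, _, hk⟩ => hx ⟨k, hk⟩
          have h2 : x ∉ {x : ℕ | ∃ n : ℕ, Nat.pair x n ∈ A} := hx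
          rw [chiD, if_neg h1, if_neg h2]
      obtain ⟨n, hn⟩ := key
      refine Set.mem_iUnion.2 ⟨n, fun m hm => ⟨b x m, ?_, ?_⟩⟩
      · unfold kleene
        rw [Denumerable.ofNat_encode, Nat.Partrec.Code.eval_curry, hc]
        simp
      · rw [← hn m hm]
        exact hb' x m
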